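/- arXiv:1310.1882 — 4 statements merged into one kernel-verified Lean document; each statement's English description precedes it below -/
import Mathlib

section
/- Let (Ω, 𝓕, P) be a probability space and (θ_n)_{n≥1} a sequence of measurable functions θ_n : Ω → [0,∞). Then there exists a sequence (ψ_n)_{n≥1} such that each ψ_n is a finite convex combination of θ_n, θ_{n+1}, θ_{n+2}, … and (ψ_n) converges P-almost surely to a measurable function ψ : Ω → [0,∞]. Moreover: (i) if the collection of all finite convex combinations of (θ_n, θ_{n+1}, …), over all n, is bounded in probability, then ψ < ∞ almost surely; (ii) if there exist β > 0 and δ > 0 such that P(θ_n > β) > δ for all n, then P(ψ > 0) > 0. -/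
open MeasureTheory Filter Topology

/-- `g` is a finite convex combination of `θ n, θ (n+1), …`. -/
def IsConvexComb {Ω : Type*} (θ : ℕ → Ω → ℝ) (n : ℕ) (g : Ω → ℝ) : Prop :=
  ∃ N : ℕ, n ≤ N ∧ ∃ lam : ℕ → ℝ, (∀ k, 0 ≤ lam k) ∧
    (∑ k ∈ Finset.Icc n N, lam k) = 1 ∧
    ∀ ω, g ω = ∑ k ∈ Finset.Icc n N, lam k * θ k ω

namespace IsConvexComb

variable {Ω : Type*} {θ : ℕ → Ω → ℝ} {m n : ℕ} {g h : Ω → ℝ}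

lemma self (θ : ℕ → Ω → ℝ) (n : ℕ) : IsConvexComb θ n (θ n) :=
  ⟨n, le_rfl, fun _ => 1, fun _ => zero_le_one, by simp, fun ω => by simp⟩

/-- The weights of a convex combination can be extended by zero to any larger interval. -/
lemma exists_weights (hg : IsConvexComb θ m g) (hnm : n ≤ m) :
    ∃ N₀ : ℕ, n ≤ N₀ ∧ ∀ N, N₀ ≤ N → ∃ lam : ℕ → ℝ, (∀ k, 0 ≤ lam k) ∧
      (∑ k ∈ Finset.Icc n N, lam k) = 1 ∧
      ∀ ω, g ω = ∑ k ∈ Finset.Icc n N, lam k * θ k ω := by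
  obtain ⟨N₀, hN₀, lam, hlam, hsum, hval⟩ := hg
  refine ⟨N₀, hnm.trans hN₀, fun N hN =>
    ⟨fun k => if k ∈ Finset.Icc m N₀ then lam k else 0, fun k => ?_, ?_, fun ω => ?_⟩⟩
  · dsimp only
    split_ifs
    exacts [hlam k, le_rfl]
  · rw [Finset.sum_ite_mem, Finset.inter_eq_right.2 (Finset.Icc_subset_Icc hnm hN), hsum]
  · simp_rw [ite_mul, zero_mul]
    rw [Finset.sum_ite_mem, Finset.inter_eq_right.2 (Finset.Icc_subset_Icc hnm hN), hval]

lemma mono (hg : IsConvexComb θ m g) (hnm : n ≤ m) : IsConvexComb θ n g := by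
  obtain ⟨N₀, hN₀, H⟩ := hg.exists_weights hnm
  exact ⟨N₀, hN₀, H N₀ le_rfl⟩

lemma midpoint (hg : IsConvexComb θ n g) (hh : IsConvexComb θ n h) :
    IsConvexComb θ n (fun ω => (g ω + h ω) / 2) := by
  obtain ⟨N₁, hN₁, H₁⟩ := hg.exists_weights le_rfl
  obtain ⟨N₂, -, H₂⟩ := hh.exists_weights le_rfl
  obtain ⟨a, ha, hasum, haval⟩ := H₁ (max N₁ N₂) (le_max_left _ _)
  obtain ⟨b, hb, hbsum, hbval⟩ := H₂ (max N₁ N₂) (le_max_right _ _)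
  refine ⟨max N₁ N₂, hN₁.trans (le_max_left _ _), fun k => (a k + b k) / 2,
    fun k => by have := ha k; have := hb k; positivity, ?_, fun ω => ?_⟩
  · rw [← Finset.sum_div, Finset.sum_add_distrib, hasum, hbsum]
    norm_num
  · simp only [haval, hbval]
    rw [← Finset.sum_add_distrib, Finset.sum_div]
    exact Finset.sum_congr rfl fun k _ => by ring

lemma nonneg (hg : IsConvexComb θ n g) (hnn : ∀ n ω, 0 ≤ θ n ω) (ω : Ω) : 0 ≤ g ω := by
  obtain ⟨N, -, lam, hlam, -, hval⟩ := hg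
  rw [hval]
  exact Finset.sum_nonneg fun k _ => mul_nonneg (hlam k) (hnn k ω)

lemma measurable [MeasurableSpace Ω] (hg : IsConvexComb θ n g) (hmeas : ∀ n, Measurable (θ n)) :
    Measurable g := by
  obtain ⟨N, -, lam, -, -, hval⟩ := hg
  rw [funext hval]
  exact Finset.measurable_fun_sum _ fun k _ => (hmeas k).const_mul _

end IsConvexComb

section

variable {Ω : Type*} [MeasurableSpace Ω] {P : Measure Ω} [IsProbabilityMeasure P]

lemma integrable_exp_neg {g : Ω → ℝ} (hg : Measurable g) (h0 : ∀ ω, 0 ≤ g ω) :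
    Integrable (fun ω => Real.exp (-g ω)) P :=
  Integrable.of_bound (by fun_prop) 1 (ae_of_all _ fun ω => by simpa using h0 ω)

/-- A uniform bound on the Laplace functional at the `θ k` passes to their convex combinations. -/
lemma IsConvexComb.integral_exp_neg_le {θ : ℕ → Ω → ℝ} {n : ℕ} {g : Ω → ℝ} {c : ℝ}
    (hg : IsConvexComb θ n g) (hmeas : ∀ n, Measurable (θ n)) (hnn : ∀ n ω, 0 ≤ θ n ω)
    (hc : ∀ k, ∫ ω, Real.exp (-θ k ω) ∂P ≤ c) : ∫ ω, Real.exp (-g ω) ∂P ≤ c := by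
  have hint := integrable_exp_neg (P := P) (hg.measurable hmeas) (hg.nonneg hnn)
  obtain ⟨N, -, lam, hlam, hsum, hval⟩ := hg
  have hi : ∀ k, Integrable (fun ω => lam k * Real.exp (-θ k ω)) P := fun k =>
    (integrable_exp_neg (hmeas k) (hnn k)).const_mul _
  calc ∫ ω, Real.exp (-g ω) ∂P
      ≤ ∫ ω, ∑ k ∈ Finset.Icc n N, lam k * Real.exp (-θ k ω) ∂P := by
        refine integral_mono hint (integrable_finsetSum _ fun k _ => hi k) fun ω => ?_
        have := convexOn_exp.map_sum_le (t := Finset.Icc n N) (w := lam) (p := fun k => -θ k ω)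
          (fun k _ => hlam k) hsum (fun _ _ => Set.mem_univ _)
        simpa [hval ω, Finset.sum_neg_distrib] using this
    _ = ∑ k ∈ Finset.Icc n N, lam k * ∫ ω, Real.exp (-θ k ω) ∂P := by
        rw [integral_finsetSum _ fun k _ => hi k]
        simp_rw [integral_const_mul]
    _ ≤ ∑ k ∈ Finset.Icc n N, lam k * c :=
        Finset.sum_le_sum fun k _ => mul_le_mul_of_nonneg_left (hc k) (hlam k)
    _ = c := by rw [← Finset.sum_mul, hsum, one_mul]

/-- A nonnegative function exceeding `β` with probability at least `δ` has Laplace functional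
bounded away from `1`. -/
lemma integral_exp_neg_le_of_measure_gt {f : Ω → ℝ} (hf : Measurable f) (h0 : ∀ ω, 0 ≤ f ω)
    {β δ : ℝ} (hβ : 0 < β) (h : ENNReal.ofReal δ < P {ω | β < f ω}) :
    ∫ ω, Real.exp (-f ω) ∂P ≤ 1 - δ * (1 - Real.exp (-β)) := by
  have hs : MeasurableSet {ω | β < f ω} := measurableSet_lt measurable_const hf
  have hδ : δ ≤ P.real {ω | β < f ω} :=
    (ENNReal.ofReal_le_iff_le_toReal (measure_ne_top _ _)).1 h.le
  have hb : 0 ≤ 1 - Real.exp (-β) := by simpa using hβ.le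
  have hi : Integrable ({ω | β < f ω}.indicator fun _ => 1 - Real.exp (-β)) P :=
    (integrable_const _).indicator hs
  calc ∫ ω, Real.exp (-f ω) ∂P
      ≤ ∫ ω, (1 - {ω | β < f ω}.indicator (fun _ => 1 - Real.exp (-β)) ω) ∂P := by
        refine integral_mono (integrable_exp_neg hf h0) ((integrable_const _).sub hi) fun ω => ?_
        by_cases hω : β < f ω
        · simpa [hω] using hω.le
        · simpa [hω] using h0 ω
    _ = 1 - P.real {ω | β < f ω} * (1 - Real.exp (-β)) := by
        rw [integral_sub (integrable_const _) hi, integral_indicator_const _ hs]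
        simp
    _ ≤ 1 - δ * (1 - Real.exp (-β)) := by gcongr

lemma memLp_exp_neg_half {g : Ω → ℝ} (hg : Measurable g) (h0 : ∀ ω, 0 ≤ g ω) :
    MemLp (fun ω => Real.exp (-(g ω / 2))) 2 P :=
  MemLp.of_bound (by fun_prop) 1 (ae_of_all _ fun ω => by simpa using div_nonneg (h0 ω) zero_le_two)

/-- The parallelogram identity behind the strict convexity of the Laplace functional. -/
lemma norm_toLp_exp_neg_half_sub_sq {g h : Ω → ℝ} (hg : Measurable g) (hg0 : ∀ ω, 0 ≤ g ω)
    (hh : Measurable h) (hh0 : ∀ ω, 0 ≤ h ω) :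
    ‖(memLp_exp_neg_half (P := P) hg hg0).toLp - (memLp_exp_neg_half (P := P) hh hh0).toLp‖ ^ 2 =
      ∫ ω, Real.exp (-g ω) ∂P + ∫ ω, Real.exp (-h ω) ∂P
        - 2 * ∫ ω, Real.exp (-((g ω + h ω) / 2)) ∂P := by
  have key : ∀ {u v : Ω → ℝ} (hu : Measurable u) (hu0 : ∀ ω, 0 ≤ u ω) (hv : Measurable v)
      (hv0 : ∀ ω, 0 ≤ v ω), inner ℝ (memLp_exp_neg_half (P := P) hu hu0).toLp
        (memLp_exp_neg_half (P := P) hv hv0).toLp = ∫ ω, Real.exp (-((u ω + v ω) / 2)) ∂P := by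
    intro u v hu hu0 hv hv0
    rw [L2.inner_def]
    refine integral_congr_ae ?_
    filter_upwards [(memLp_exp_neg_half (P := P) hu hu0).coeFn_toLp,
      (memLp_exp_neg_half (P := P) hv hv0).coeFn_toLp] with ω h1 h2
    rw [h1, h2, real_inner_eq_re_inner, RCLike.inner_apply]
    simp only [conj_trivial, RCLike.re_to_real]
    rw [← Real.exp_add]
    congr 1
    ring
  rw [norm_sub_sq_real, ← real_inner_self_eq_norm_sq, ← real_inner_self_eq_norm_sq,
    key hg hg0 hg hg0, key hg hg0 hh hh0, key hh hh0 hh hh0]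
  simp only [add_self_div_two]
  ring

/-- Nonnegative reals converge in `[0, ∞]` as soon as their images under `x ↦ exp (-x / 2)`
converge. -/
lemma exists_tendsto_ofReal_of_tendsto_exp_neg_half {x : ℕ → ℝ} {y : ℝ}
    (h : Tendsto (fun n => Real.exp (-(x n / 2))) atTop (𝓝 y)) :
    ∃ z, Tendsto (fun n => ENNReal.ofReal (x n)) atTop (𝓝 z) := by
  have hc : Continuous fun t : ℝ => (ENNReal.log ((ENNReal.ofReal t)⁻¹ ^ 2)).toENNReal :=
    EReal.continuous_toENNReal.comp (ENNReal.continuous_log.comp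
      ((ENNReal.continuous_pow 2).comp (continuous_inv.comp ENNReal.continuous_ofReal)))
  refine ⟨_, ((hc.tendsto y).comp h).congr fun n => ?_⟩
  simp only [Function.comp_apply]
  rw [← ENNReal.ofReal_inv_of_pos (Real.exp_pos _), ← ENNReal.ofReal_pow (by positivity),
    ENNReal.log_ofReal_of_pos (by positivity), ← Real.exp_neg, ← Real.exp_nat_mul, Real.log_exp,
    EReal.toENNReal_of_ne_top (EReal.coe_ne_top _), EReal.toReal_coe]
  congr 1
  push_cast
  ring

/-- Forward convex combinations of nonnegative functions, chosen to almost minimize the Laplace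
functional, converge almost surely in `[0, ∞]` along a subsequence. -/
lemma exists_isConvexComb_ae_tendsto {θ : ℕ → Ω → ℝ} (hmeas : ∀ n, Measurable (θ n))
    (hnn : ∀ n ω, 0 ≤ θ n ω) :
    ∃ g : ℕ → Ω → ℝ, (∀ n, IsConvexComb θ n (g n)) ∧
      ∀ᵐ ω ∂P, ∃ z, Tendsto (fun n => ENNReal.ofReal (g n ω)) atTop (𝓝 z) := by
  let S : ℕ → Set ℝ := fun n => {r | ∃ g, IsConvexComb θ n g ∧ ∫ ω, Real.exp (-g ω) ∂P = r}
  have hne : ∀ n, (S n).Nonempty := fun n => ⟨_, θ n, IsConvexComb.self θ n, rfl⟩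
  have hbdd : ∀ n, BddBelow (S n) := by
    refine fun n => ⟨0, ?_⟩
    rintro _ ⟨g, -, rfl⟩
    exact integral_nonneg fun ω => (Real.exp_pos _).le
  have hle : ∀ {n g}, IsConvexComb θ n g → sInf (S n) ≤ ∫ ω, Real.exp (-g ω) ∂P :=
    fun {n g} hg => csInf_le (hbdd n) ⟨g, hg, rfl⟩
  have hmono : Monotone fun n => sInf (S n) := fun n m hnm =>
    le_csInf (hne m) (by rintro _ ⟨g, hg, rfl⟩; exact hle (hg.mono hnm))
  have hone : ∀ n, sInf (S n) ≤ 1 := fun n =>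
    (hle (IsConvexComb.self θ n)).trans <| by
      simpa using integral_mono (μ := P) (integrable_exp_neg (hmeas n) (hnn n))
        (integrable_const (1 : ℝ)) (fun ω => by simpa using hnn n ω)
  have hbdd' : BddAbove (Set.range fun n => sInf (S n)) :=
    ⟨1, by rintro _ ⟨n, rfl⟩; exact hone n⟩
  have hlim := tendsto_atTop_ciSup hmono hbdd'
  set d := ⨆ n, sInf (S n)
  have hex : ∀ n : ℕ, ∃ g, IsConvexComb θ n g ∧
      ∫ ω, Real.exp (-g ω) ∂P < sInf (S n) + 1 / ((n : ℝ) + 1) := by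
    intro n
    obtain ⟨_, ⟨g, hg, rfl⟩, hlt⟩ := exists_lt_of_csInf_lt (hne n)
      (lt_add_of_pos_right (sInf (S n)) (Nat.one_div_pos_of_nat (α := ℝ) (n := n)))
    exact ⟨g, hg, hlt⟩
  choose g hg hgI using hex
  have hgm := fun n => (hg n).measurable hmeas
  have hg0 := fun n => (hg n).nonneg hnn
  let F : ℕ → Lp ℝ 2 P := fun n => (memLp_exp_neg_half (P := P) (hgm n) (hg0 n)).toLp
  have hF : CauchySeq F := by
    refine cauchySeq_of_le_tendsto_0'
      (fun n => √((d - sInf (S n)) + 2 * (1 / ((n : ℝ) + 1)))) (fun n m hnm => ?_) ?_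
    · rw [dist_eq_norm]
      refine Real.le_sqrt_of_sq_le ?_
      rw [norm_toLp_exp_neg_half_sub_sq (hgm n) (hg0 n) (hgm m) (hg0 m)]
      have h1 := hle ((hg n).midpoint ((hg m).mono hnm))
      have h2 := hgI n
      have h3 := hgI m
      have h4 : sInf (S m) ≤ d := le_ciSup hbdd' m
      have h5 : 1 / ((m : ℝ) + 1) ≤ 1 / ((n : ℝ) + 1) := Nat.one_div_le_one_div hnm
      linarith
    · have := ((hlim.const_sub d).add
        ((tendsto_one_div_add_atTop_nhds_zero_nat (𝕜 := ℝ)).const_mul 2)).sqrt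
      simpa using this
  obtain ⟨f, hf⟩ := cauchySeq_tendsto_of_complete hF
  obtain ⟨ns, hns, hae⟩ := (tendstoInMeasure_of_tendsto_Lp hf).exists_seq_tendsto_ae
  refine ⟨fun n => g (ns n), fun n => (hg (ns n)).mono hns.le_apply, ?_⟩
  filter_upwards [hae, ae_all_iff.2 fun n =>
    (memLp_exp_neg_half (P := P) (hgm n) (hg0 n)).coeFn_toLp] with ω h1 h2
  exact exists_tendsto_ofReal_of_tendsto_exp_neg_half (h1.congr fun n => h2 (ns n))

end

/-- Komlós-type lemma of Delbaen–Schachermayer: from a sequence of nonnegative measurable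
functions one can extract forward convex combinations converging a.s. to a `[0,∞]`-valued
measurable function `ψ`; if all convex combinations are bounded in probability then `ψ < ∞`
a.s., and if `P(θ n > β) > δ` for all `n` then `P(ψ > 0) > 0`. -/
theorem stmt0 {Ω : Type*} [MeasurableSpace Ω] (P : Measure Ω) [IsProbabilityMeasure P]
    (θ : ℕ → Ω → ℝ) (hmeas : ∀ n, Measurable (θ n)) (hnn : ∀ n ω, 0 ≤ θ n ω) :
    ∃ (ψn : ℕ → Ω → ℝ) (ψ : Ω → ENNReal),
      (∀ n, IsConvexComb θ n (ψn n)) ∧ Measurable ψ ∧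
      (∀ᵐ ω ∂P, Tendsto (fun n => ENNReal.ofReal (ψn n ω)) atTop (𝓝 (ψ ω))) ∧
      ((∀ ε : ℝ, 0 < ε → ∃ C : ℝ, 0 < C ∧ ∀ n g, IsConvexComb θ n g →
          P {ω | C < g ω} < ENNReal.ofReal ε) → (∀ᵐ ω ∂P, ψ ω < ⊤)) ∧
      (∀ β δ : ℝ, 0 < β → 0 < δ → (∀ n, ENNReal.ofReal δ < P {ω | β < θ n ω}) →
        0 < P {ω | 0 < ψ ω}) := by
  obtain ⟨g, hg, hae⟩ := exists_isConvexComb_ae_tendsto (P := P) hmeas hnn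
  have hgm := fun n => (hg n).measurable hmeas
  have hg0 := fun n => (hg n).nonneg hnn
  have hlim : ∀ᵐ ω ∂P, Tendsto (fun n => ENNReal.ofReal (g n ω)) atTop
      (𝓝 (liminf (fun n => ENNReal.ofReal (g n ω)) atTop)) := by
    filter_upwards [hae] with ω ⟨z, hz⟩
    rwa [hz.liminf_eq]
  refine ⟨g, fun ω => liminf (fun n => ENNReal.ofReal (g n ω)) atTop, hg,
    Measurable.liminf fun n => (hgm n).ennreal_ofReal, hlim, fun hbd => ?_,
    fun β δ hβ hδ hpos => ?_⟩
  · rw [ae_iff]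
    refine le_antisymm (ENNReal.le_of_forall_pos_le_add fun ε hε _ => ?_) zero_le
    obtain ⟨C, -, hC⟩ := hbd ε hε
    have hsub : {ω | ¬ liminf (fun n => ENNReal.ofReal (g n ω)) atTop < ⊤} ⊆
        ⋃ N, ⋂ n ≥ N, {ω | C < g n ω} := by
      intro ω hω
      have htop : liminf (fun n => ENNReal.ofReal (g n ω)) atTop = ⊤ := by simpa using hω
      have hev : ∀ᶠ n in atTop, ENNReal.ofReal C < ENNReal.ofReal (g n ω) :=
        eventually_lt_of_lt_liminf (by rw [htop]; exact ENNReal.ofReal_lt_top)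
      obtain ⟨N, hN⟩ := eventually_atTop.1 hev
      simp only [Set.mem_iUnion, Set.mem_iInter, Set.mem_ofPred_eq]
      exact ⟨N, fun n hn => (ENNReal.ofReal_lt_ofReal_iff'.1 (hN n hn)).1⟩
    have hmono : Monotone fun N => ⋂ n ≥ N, {ω | C < g n ω} := fun N M hNM =>
      Set.biInter_subset_biInter_left fun n hn => hNM.trans hn
    calc P {ω | ¬ liminf (fun n => ENNReal.ofReal (g n ω)) atTop < ⊤}
        ≤ P (⋃ N, ⋂ n ≥ N, {ω | C < g n ω}) := measure_mono hsub
      _ = ⨆ N, P (⋂ n ≥ N, {ω | C < g n ω}) := hmono.measure_iUnion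
      _ ≤ ENNReal.ofReal ε := iSup_le fun N =>
          (measure_mono (Set.biInter_subset_of_mem (le_refl N))).trans (hC N _ (hg N)).le
      _ = 0 + ε := by simp
  · by_contra! hzero
    have hψ : ∀ᵐ ω ∂P, liminf (fun n => ENNReal.ofReal (g n ω)) atTop = 0 := by
      rw [ae_iff]
      simpa [pos_iff_ne_zero] using hzero
    have hexp : Tendsto (fun n => ∫ ω, Real.exp (-g n ω) ∂P) atTop (𝓝 (∫ _, (1 : ℝ) ∂P)) := by
      refine tendsto_integral_of_dominated_convergence (fun _ => (1 : ℝ))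
        (fun n => (integrable_exp_neg (hgm n) (hg0 n)).1) (integrable_const _)
        (fun n => ae_of_all _ fun ω => by simpa using hg0 n ω) ?_
      filter_upwards [hlim, hψ] with ω h1 h2
      rw [h2] at h1
      have h3 : Tendsto (fun n => g n ω) atTop (𝓝 0) := by
        simpa [Function.comp_def, ENNReal.toReal_ofReal (hg0 _ ω)] using
          (ENNReal.tendsto_toReal ENNReal.zero_ne_top).comp h1
      simpa [Function.comp_def] using (Real.continuous_exp.tendsto _).comp h3.neg
    have hle := le_of_tendsto' hexp fun n => (hg n).integral_exp_neg_le hmeas hnn fun k =>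
      integral_exp_neg_le_of_measure_gt (hmeas k) (hnn k) hβ (hpos k)
    have hb : 0 < 1 - Real.exp (-β) := by simpa using hβ
    have := mul_pos hδ hb
    simp only [integral_const, probReal_univ, smul_eq_mul, mul_one] at hle
    linarith
end

section
/- Let T > 0 and set D = ([0,T] ∩ ℚ) ∪ {T}. For each n ≥ 1 let C_n : [0,T] → ℝ be nondecreasing and let W_n : [0,T] → ℝ satisfy |W_n(t) − W_n(s)| ≤ C_n(t) − C_n(s) for all 0 ≤ s ≤ t ≤ T. Assume that for every q ∈ D the limits Ĉ(q) := lim_{n→∞} C_n(q) and lim_{n→∞} W_n(q) exist in ℝ. Define C₀(t) := inf{Ĉ(q) : q ∈ ℚ, t < q ≤ T} for t ∈ [0,T) and C₀(T) := Ĉ(T). Then C₀ is nondecreasing and right-continuous on [0,T), and for every t ∈ (0,T) at which C₀ is continuous, the limit lim_{n→∞} W_n(t) exists in ℝ. -/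
open Filter Topology Set

/-- A real sequence that is eventually `ε`-close to some convergent sequence, for every `ε > 0`,
converges. -/
theorem exists_tendsto_of_eventually_close {w : ℕ → ℝ}
    (h : ∀ ε > 0, ∃ v : ℕ → ℝ, (∃ l, Tendsto v atTop (𝓝 l)) ∧ ∀ᶠ n in atTop, |w n - v n| < ε) :
    ∃ l, Tendsto w atTop (𝓝 l) := by
  refine cauchySeq_tendsto_of_complete (Metric.cauchySeq_iff'.2 fun ε hε => ?_)
  obtain ⟨v, ⟨l, hl⟩, hv⟩ := h (ε / 4) (by linarith)
  obtain ⟨N, hN⟩ := eventually_atTop.1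
    (hv.and ((Metric.tendsto_nhds.1 hl) (ε / 4) (by linarith)))
  refine ⟨N, fun n hn => ?_⟩
  obtain ⟨h1, h2⟩ := hN n hn
  obtain ⟨h3, h4⟩ := hN N le_rfl
  rw [Real.dist_eq] at *
  rw [abs_lt] at *
  constructor <;> linarith [h1.1, h1.2, h2.1, h2.2, h3.1, h3.2, h4.1, h4.2]

/-- Let `D = ([0,T] ∩ ℚ) ∪ {T}`, let `Cn n` be nondecreasing on `[0,T]` controlling the
variation of `Wn n`, and suppose `Cn n q → Chat q` and `Wn n q` converges for every `q ∈ D`.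
Define `C0` as the right-continuous envelope `C0 t = inf {Chat q | q ∈ ℚ, t < q ≤ T}` for
`t ∈ [0,T)` and `C0 T = Chat T`. Then `C0` is nondecreasing and right-continuous on `[0,T)`,
and at every continuity point `t ∈ (0,T)` of `C0` the sequence `Wn n t` converges. -/
theorem stmt3 (T : ℝ) (hT : 0 < T)
    (Cn Wn : ℕ → ℝ → ℝ) (Chat C0 : ℝ → ℝ)
    (hmono : ∀ n, MonotoneOn (Cn n) (Icc 0 T))
    (hctrl : ∀ n, ∀ s t : ℝ, 0 ≤ s → s ≤ t → t ≤ T →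
      |Wn n t - Wn n s| ≤ Cn n t - Cn n s)
    (hChat : ∀ q ∈ ({t : ℝ | (∃ r : ℚ, (r : ℝ) = t) ∧ t ∈ Icc (0 : ℝ) T} ∪ {T}),
      Tendsto (fun n => Cn n q) atTop (𝓝 (Chat q)))
    (hWlim : ∀ q ∈ ({t : ℝ | (∃ r : ℚ, (r : ℝ) = t) ∧ t ∈ Icc (0 : ℝ) T} ∪ {T}),
      ∃ l : ℝ, Tendsto (fun n => Wn n q) atTop (𝓝 l))
    (hC0 : ∀ t ∈ Ico (0 : ℝ) T,
      C0 t = sInf {x : ℝ | ∃ q : ℚ, t < (q : ℝ) ∧ (q : ℝ) ≤ T ∧ x = Chat (q : ℝ)})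
    (hC0T : C0 T = Chat T) :
    MonotoneOn C0 (Ico 0 T) ∧
    (∀ t ∈ Ico (0 : ℝ) T, ContinuousWithinAt C0 (Ico t T) t) ∧
    (∀ t ∈ Ioo (0 : ℝ) T, ContinuousWithinAt C0 (Icc 0 T) t →
      ∃ l : ℝ, Tendsto (fun n => Wn n t) atTop (𝓝 l)) := by
  have hmem : ∀ q : ℚ, (0 : ℝ) ≤ q → (q : ℝ) ≤ T →
      (q : ℝ) ∈ ({t : ℝ | (∃ r : ℚ, (r : ℝ) = t) ∧ t ∈ Icc (0 : ℝ) T} ∪ {T}) :=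
    fun q h0 h1 => Or.inl ⟨⟨q, rfl⟩, h0, h1⟩
  have hChat_mono : ∀ p q : ℚ, (0 : ℝ) ≤ p → (p : ℝ) ≤ q → (q : ℝ) ≤ T →
      Chat p ≤ Chat q := fun p q h0 hpq hqT =>
    le_of_tendsto_of_tendsto' (hChat p (hmem p h0 (hpq.trans hqT)))
      (hChat q (hmem q (h0.trans hpq) hqT))
      fun n => hmono n ⟨h0, hpq.trans hqT⟩ ⟨h0.trans hpq, hqT⟩ hpq
  have hbdd : ∀ t ∈ Ico (0 : ℝ) T,
      BddBelow {x : ℝ | ∃ q : ℚ, t < (q : ℝ) ∧ (q : ℝ) ≤ T ∧ x = Chat (q : ℝ)} := by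
    rintro t ⟨ht0, -⟩
    refine ⟨Chat ((0 : ℚ) : ℝ), ?_⟩
    rintro x ⟨q, htq, hqT, rfl⟩
    exact hChat_mono 0 q (by simp) (by simpa using (ht0.trans_lt htq).le) hqT
  have hne : ∀ t ∈ Ico (0 : ℝ) T,
      {x : ℝ | ∃ q : ℚ, t < (q : ℝ) ∧ (q : ℝ) ≤ T ∧ x = Chat (q : ℝ)}.Nonempty := by
    rintro t ⟨-, htT⟩
    obtain ⟨q, h1, h2⟩ := exists_rat_btwn htT
    exact ⟨_, q, h1, h2.le, rfl⟩
  have hC0_le : ∀ t ∈ Ico (0 : ℝ) T, ∀ q : ℚ, t < q → (q : ℝ) ≤ T → C0 t ≤ Chat q := by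
    intro t ht q h1 h2
    rw [hC0 t ht]
    exact csInf_le (hbdd t ht) ⟨q, h1, h2, rfl⟩
  have hle_C0 : ∀ t ∈ Ico (0 : ℝ) T, ∀ q : ℚ, (0 : ℝ) ≤ q → (q : ℝ) ≤ t → Chat q ≤ C0 t := by
    intro t ht q h0 h1
    rw [hC0 t ht]
    refine le_csInf (hne t ht) ?_
    rintro x ⟨r, h2, h3, rfl⟩
    exact hChat_mono q r h0 (h1.trans h2.le) h3
  have hC0_mono : MonotoneOn C0 (Ico 0 T) := by
    intro s hs t ht hst
    rw [hC0 s hs, hC0 t ht]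
    refine csInf_le_csInf (hbdd s hs) (hne t ht) ?_
    rintro x ⟨q, h1, h2, h3⟩
    exact ⟨q, hst.trans_lt h1, h2, h3⟩
  refine ⟨hC0_mono, fun t ht => ?_, fun t ht hcont => ?_⟩
  · refine Metric.continuousWithinAt_iff.2 fun ε hε => ?_
    obtain ⟨x, ⟨q, htq, hqT, rfl⟩, hx⟩ := exists_lt_of_csInf_lt (hne t ht)
      (lt_add_of_pos_right _ hε)
    rw [← hC0 t ht] at hx
    refine ⟨q - t, sub_pos.2 htq, fun u hu hdist => ?_⟩
    rw [Real.dist_eq, abs_lt] at *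
    have hu' : u ∈ Ico 0 T := ⟨ht.1.trans hu.1, hu.2⟩
    have h1 := hC0_mono ht hu' hu.1
    have h2 := hC0_le u hu' q (by linarith [hdist.2]) hqT
    constructor <;> linarith
  · refine exists_tendsto_of_eventually_close fun ε hε => ?_
    obtain ⟨δ, hδ, hclose⟩ := Metric.continuousWithinAt_iff.1 hcont (ε / 2) (by linarith)
    obtain ⟨u, hu, hut⟩ := exists_between (max_lt ht.1 (sub_lt_self t hδ))
    obtain ⟨hu0, huδ⟩ := max_lt_iff.1 hu
    obtain ⟨p, hup, hpt⟩ := exists_rat_btwn hut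
    obtain ⟨q, htq, hq⟩ := exists_rat_btwn (lt_min ht.2 (lt_add_of_pos_right t hδ))
    obtain ⟨hqT, hqδ⟩ := lt_min_iff.1 hq
    have hpT : (p : ℝ) ≤ T := (hpt.trans ht.2).le
    have hp0 : (0 : ℝ) ≤ p := (hu0.trans hup).le
    have hq0 : (0 : ℝ) ≤ q := (ht.1.trans htq).le
    have h1 := hclose (x := u) ⟨hu0.le, (hut.trans ht.2).le⟩
      (by rw [Real.dist_eq, abs_lt]; constructor <;> linarith)
    have h2 := hclose (x := (q : ℝ)) ⟨hq0, hqT.le⟩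
      (by rw [Real.dist_eq, abs_lt]; constructor <;> linarith)
    rw [Real.dist_eq, abs_lt] at h1 h2
    have h3 := hC0_le u ⟨hu0.le, hut.trans ht.2⟩ p hup hpT
    have h4 := hle_C0 q ⟨hq0, hqT⟩ q hq0 le_rfl
    have hlim := (hChat q (hmem q hq0 hqT.le)).sub (hChat p (hmem p hp0 hpT))
    refine ⟨fun n => Wn n p, hWlim p (hmem p hp0 hpT), ?_⟩
    filter_upwards [hlim.eventually_lt_const (show Chat q - Chat p < ε by
      linarith [h1.1, h2.2])] with n hn
    have h5 := hctrl n p t hp0 hpt.le ht.2.le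
    have h6 := hmono n ⟨ht.1.le, ht.2.le⟩ ⟨hq0, hqT.le⟩ htq.le
    linarith
end

section
/- Consider the discrete trading model with times 0 = τ_0 < τ_1 < ⋯ < τ_n = T. Suppose the holdings in the riskless asset satisfy the self-financing condition Z⁰_i − Z⁰_{i−1} = −M_i(ΔZ_i)ΔZ_i − ½ P_i(ΔZ_i) sgn(ΔZ_i) ΔZ_i for i = 1, …, n, and define the portfolio value V_i = Z⁰_i + Z¹_i (M_i(0) + ½ sgn(ΔZ_i) P_i(0)) for i = 0, 1, …, n (with ΔZ_0 := Z¹_0). Then the terminal value satisfies the identity V_n = V_0 + Σ_{i=1}^n Z¹_{i−1}(M_i(0) − M_{i−1}(0)) + ½ Σ_{i=1}^n Z¹_{i−1}(sgn(ΔZ_i)P_i(0) − sgn(ΔZ_{i−1})P_{i−1}(0)) − T_n, where T_n = Σ_{i=1}^n (M_i(ΔZ_i) − M_i(0))ΔZ_i + ½ Σ_{i=1}^n (P_i(ΔZ_i) − P_i(0)) sgn(ΔZ_i) ΔZ_i is the transaction-cost term. -/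
/-- Discrete self-financing identity: if the riskless holdings satisfy the self-financing
condition and the portfolio value is marked to the marginal mid-price adjusted by half the
signed spread, then the terminal value decomposes into the initial value, the mid-price
capital gain, the signed-spread gain, minus the accumulated transaction costs.
(The paper's trading times `τ_1, …, τ_n` correspond to indices `i+1`, `i ∈ range n`.) -/
theorem stmt7 (n : ℕ) (M P : ℕ → ℝ → ℝ) (Z1 Z0 : ℕ → ℝ) (dZ : ℕ → ℝ) (V : ℕ → ℝ)
    (hdZ0 : dZ 0 = Z1 0)
    (hdZ : ∀ i : ℕ, dZ (i + 1) = Z1 (i + 1) - Z1 i)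
    (hsf : ∀ i < n, Z0 (i + 1) - Z0 i =
      -(M (i + 1) (dZ (i + 1)) * dZ (i + 1))
        - (1 / 2) * P (i + 1) (dZ (i + 1)) * Real.sign (dZ (i + 1)) * dZ (i + 1))
    (hV : ∀ i ≤ n, V i = Z0 i + Z1 i * (M i 0 + (1 / 2) * Real.sign (dZ i) * P i 0)) :
    V n = V 0
      + (∑ i ∈ Finset.range n, Z1 i * (M (i + 1) 0 - M i 0))
      + (1 / 2) * (∑ i ∈ Finset.range n,
          Z1 i * (Real.sign (dZ (i + 1)) * P (i + 1) 0 - Real.sign (dZ i) * P i 0))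
      - ((∑ i ∈ Finset.range n, (M (i + 1) (dZ (i + 1)) - M (i + 1) 0) * dZ (i + 1))
        + (1 / 2) * (∑ i ∈ Finset.range n,
            (P (i + 1) (dZ (i + 1)) - P (i + 1) 0) * Real.sign (dZ (i + 1)) * dZ (i + 1))) := by
  have step : ∀ i ∈ Finset.range n, V (i + 1) - V i =
      Z1 i * (M (i + 1) 0 - M i 0)
        + (1 / 2) * (Z1 i * (Real.sign (dZ (i + 1)) * P (i + 1) 0 - Real.sign (dZ i) * P i 0))
        - ((M (i + 1) (dZ (i + 1)) - M (i + 1) 0) * dZ (i + 1)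
          + (1 / 2) *
            ((P (i + 1) (dZ (i + 1)) - P (i + 1) 0) * Real.sign (dZ (i + 1)) * dZ (i + 1))) := by
    intro i hi
    have hin : i < n := Finset.mem_range.mp hi
    have hZ1 : Z1 (i + 1) = Z1 i + dZ (i + 1) := by rw [hdZ i]; ring
    rw [hV (i + 1) hin, hV i hin.le, hZ1]
    linear_combination hsf i hin
  have total := Finset.sum_congr rfl step
  rw [Finset.sum_range_sub, Finset.sum_sub_distrib, Finset.sum_add_distrib,
    Finset.sum_add_distrib, ← Finset.mul_sum, ← Finset.mul_sum] at total
  linear_combination total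
end

section
/- Consider the discrete trading model with times 0 = τ_0 < τ_1 < ⋯ < τ_n = T, and suppose there is a constant k > 0 such that for each i and all y ∈ ℝ one has (A_i(y) − A_i(0))·y ≥ k y² and (B_i(y) − B_i(0))·y ≥ k y² (which holds in particular if A_i and B_i are differentiable with A_i′ ≥ k and B_i′ ≥ k), where M_i = (A_i + B_i)/2 and P_i = A_i − B_i. Then for any stock holdings Z¹_0, …, Z¹_n, the transaction cost satisfies T_n = Σ_{i=1}^n (M_i(ΔZ_i) − M_i(0))ΔZ_i + ½ Σ_{i=1}^n (P_i(ΔZ_i) − P_i(0)) sgn(ΔZ_i) ΔZ_i ≥ k Σ_{i=1}^n (ΔZ_i)²; that is, the accumulated transaction cost dominates a positive multiple of the discrete quadratic variation of the trading strategy. -/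
/-- If the ask and bid price functions satisfy the uniform-slope conditions
`(A i y - A i 0) y ≥ k y²` and `(B i y - B i 0) y ≥ k y²` with `k > 0`, mid-price
`M i = (A i + B i)/2` and spread `P i = A i - B i`, then the accumulated transaction cost
dominates `k` times the discrete quadratic variation of the trading strategy. -/
theorem stmt9 (n : ℕ) (A B : ℕ → ℝ → ℝ) (k : ℝ) (hk : 0 < k)
    (hA : ∀ i (y : ℝ), k * y ^ 2 ≤ (A i y - A i 0) * y)
    (hB : ∀ i (y : ℝ), k * y ^ 2 ≤ (B i y - B i 0) * y)
    (M P : ℕ → ℝ → ℝ)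
    (hM : ∀ i y, M i y = (A i y + B i y) / 2)
    (hP : ∀ i y, P i y = A i y - B i y)
    (Z1 : ℕ → ℝ) (dZ : ℕ → ℝ)
    (hdZ0 : dZ 0 = Z1 0)
    (hdZ : ∀ i : ℕ, dZ (i + 1) = Z1 (i + 1) - Z1 i) :
    k * ∑ i ∈ Finset.range n, dZ (i + 1) ^ 2 ≤
      (∑ i ∈ Finset.range n, (M (i + 1) (dZ (i + 1)) - M (i + 1) 0) * dZ (i + 1))
        + (1 / 2) * (∑ i ∈ Finset.range n,
            (P (i + 1) (dZ (i + 1)) - P (i + 1) 0) * Real.sign (dZ (i + 1)) * dZ (i + 1)) := by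
  rw [Finset.mul_sum, Finset.mul_sum, ← Finset.sum_add_distrib]
  refine Finset.sum_le_sum fun i _ => ?_
  generalize dZ (i + 1) = y
  have hAy := hA (i + 1) y
  have hBy := hB (i + 1) y
  simp only [hM, hP]
  rcases lt_trichotomy y 0 with h | rfl | h
  · rw [Real.sign_of_neg h]
    linarith
  · simp
  · rw [Real.sign_of_pos h]
    linarith
end
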